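/- As n → ∞, sup over θ ∈ [n^{−3/4}, π/2] of (P_n'(cos θ) · sin θ)² / P_n'(1) tends to 0; more precisely, there exist C and N such that for all n ≥ N and θ ∈ [n^{−3/4}, π/2], (P_n'(cos θ) · sin θ)² / P_n'(1) ≤ C n^{−1/4}. -/

import Mathlib

open Real

/-- The degree-`n` Legendre polynomial, via the Rodrigues formula. -/
noncomputable def legendre (n : ℕ) (x : ℝ) : ℝ :=
  (1 / (2 ^ n * (n.factorial : ℝ))) * iteratedDeriv n (fun t : ℝ => (t ^ 2 - 1) ^ n) x

open Polynomial in
/-- The polynomial `((X² - 1) ^ n)⁽ⁿ⁾ / (2 ^ n n!)`. -/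
noncomputable def legendrePoly (n : ℕ) : ℝ[X] :=
  C (1 / (2 ^ n * (n.factorial : ℝ))) * derivative^[n] ((X ^ 2 - 1) ^ n)

namespace legendrePoly

open Polynomial

theorem legendre_eq_eval (n : ℕ) : legendre n = fun x => (legendrePoly n).eval x := by
  have key : ∀ (k : ℕ) (p : ℝ[X]),
      iteratedDeriv k (fun x => p.eval x) = fun x => (derivative^[k] p).eval x := by
    intro k
    induction k with
    | zero => intro p; simp
    | succ k ih =>
      intro p
      rw [iteratedDeriv_succ', Function.iterate_succ_apply, ← ih]
      congr 1
      ext x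
      exact p.deriv
  have h := key n ((X ^ 2 - 1) ^ n)
  have hf : (fun t : ℝ => (t ^ 2 - 1) ^ n) = fun x => ((X ^ 2 - 1 : ℝ[X]) ^ n).eval x := by
    ext x; simp
  ext x
  rw [legendre, hf, h, legendrePoly, eval_mul, eval_C]

theorem deriv_legendre (n : ℕ) (x : ℝ) :
    deriv (legendre n) x = (derivative (legendrePoly n)).eval x := by
  rw [legendre_eq_eval]
  exact (legendrePoly n).deriv

/-- The relation obtained by differentiating `(X² - 1) w' = 2 n X w`, `w = (X² - 1) ^ n`,
`k + 1` times. -/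
theorem iterate_derivative_relation (n k : ℕ) :
    (X ^ 2 - 1) * derivative^[k + 2] ((X ^ 2 - 1 : ℝ[X]) ^ n) =
      C (2 * n - 2 - 2 * k : ℝ) * (X * derivative^[k + 1] ((X ^ 2 - 1 : ℝ[X]) ^ n)) +
        C ((k + 1) * (2 * n - k) : ℝ) * derivative^[k] ((X ^ 2 - 1 : ℝ[X]) ^ n) := by
  induction k with
  | zero =>
    have h : (X ^ 2 - 1) * derivative ((X ^ 2 - 1 : ℝ[X]) ^ n) =
        C (2 * n : ℝ) * (X * (X ^ 2 - 1 : ℝ[X]) ^ n) := by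
      rcases n with _ | n
      · simp
      · simp [derivative_pow]
        ring
    have h' := congrArg derivative h
    simp only [derivative_mul, derivative_sub, derivative_X_pow, derivative_one, derivative_C,
      derivative_X] at h'
    simp only [Function.iterate_succ_apply', Function.iterate_zero_apply, map_sub, map_mul, map_add,
      map_natCast, map_ofNat, Nat.cast_zero, Nat.cast_ofNat, map_one, map_zero] at h' ⊢
    linear_combination h'
  | succ k ih =>
    have h' := congrArg derivative ih
    simp only [derivative_mul, derivative_sub, derivative_add, derivative_X_pow, derivative_one,
      derivative_C, derivative_X, ← Function.iterate_succ_apply' (f := derivative)] at h'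
    simp only [Nat.succ_eq_add_one, map_sub, map_mul, map_add,
      map_natCast, map_ofNat, Nat.cast_add, Nat.cast_one, Nat.cast_ofNat, map_one,
      add_assoc, Nat.reduceAdd] at h' ⊢
    linear_combination h'

/-- Legendre's differential equation. -/
theorem differential_equation (n : ℕ) (x : ℝ) :
    (1 - x ^ 2) * (derivative (derivative (legendrePoly n))).eval x
      - 2 * x * (derivative (legendrePoly n)).eval x
      + n * (n + 1) * (legendrePoly n).eval x = 0 := by
  have h := congrArg (eval x) (iterate_derivative_relation n n)
  simp only [Function.iterate_succ_apply', eval_mul, eval_add, eval_sub, eval_pow, eval_X, eval_C,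
    eval_one] at h
  simp only [legendrePoly, derivative_C_mul, eval_mul, eval_C]
  linear_combination (-(1 / (2 ^ n * (n.factorial : ℝ)))) * h

theorem eval_one_iterate_derivative (k : ℕ) (q : ℝ[X]) :
    (derivative^[k] ((X - 1) ^ k * q)).eval 1 = k.factorial * q.eval 1 := by
  induction k generalizing q with
  | zero => simp
  | succ k ih =>
    have h : derivative ((X - 1) ^ (k + 1) * q) =
        (X - 1) ^ k * ((k + 1 : ℝ[X]) * q + (X - 1) * derivative q) := by
      simp [derivative_mul, derivative_pow]
      ring
    rw [Function.iterate_succ_apply, h, ih, Nat.factorial_succ]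
    simp
    ring

theorem eval_one (n : ℕ) : (legendrePoly n).eval 1 = 1 := by
  have h : (X ^ 2 - 1 : ℝ[X]) ^ n = (X - 1) ^ n * (X + 1) ^ n := by
    rw [← mul_pow]; ring
  rw [legendrePoly, h, eval_mul, eval_C, eval_one_iterate_derivative]
  have := n.factorial_ne_zero
  simp only [eval_pow, eval_add, eval_X, Polynomial.eval_one]
  field_simp
  norm_num

theorem eval_one_derivative (n : ℕ) :
    (derivative (legendrePoly n)).eval 1 = n * (n + 1) / 2 := by
  have h := differential_equation n 1
  rw [eval_one] at h
  linear_combination (-1 / 2 : ℝ) * h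

theorem coeff_X_sq_sub_one_pow (n k : ℕ) :
    ((X ^ 2 - 1 : ℝ[X]) ^ n).coeff k =
      if 2 ∣ k then (-1) ^ (n - k / 2) * (n.choose (k / 2) : ℝ) else 0 := by
  have h : (X ^ 2 - 1 : ℝ[X]) ^ n = expand ℝ 2 ((X + C (-1)) ^ n) := by simp [sub_eq_add_neg]
  rw [h, coeff_expand two_pos, coeff_X_add_C_pow]

/-- `centralBinom m ≤ 4 ^ m / √(2 m + 1)`, in squared form. -/
theorem centralBinom_sq_le (m : ℕ) :
    (2 * m + 1) * ((m.centralBinom : ℝ) / 4 ^ m) ^ 2 ≤ 1 := by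
  induction m with
  | zero => simp
  | succ m ih =>
    have h : ((m + 1 : ℕ) : ℝ) * (m + 1).centralBinom = 2 * (2 * m + 1) * m.centralBinom := by
      exact_mod_cast m.succ_mul_centralBinom_succ
    push_cast at h ⊢
    have hm : (0 : ℝ) < m + 1 := by positivity
    have e : ((m + 1).centralBinom : ℝ) / 4 ^ (m + 1) =
        (2 * m + 1) / (2 * (m + 1)) * (m.centralBinom / 4 ^ m) := by
      rw [pow_succ]
      field_simp
      linear_combination 2 * h
    rw [e]
    refine le_trans ?_ ih
    rw [mul_pow, ← mul_assoc]
    gcongr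
    rw [div_pow, mul_div_assoc', div_le_iff₀ (by positivity)]
    nlinarith

theorem eval_zero (n : ℕ) :
    (legendrePoly n).eval 0 = ((X ^ 2 - 1 : ℝ[X]) ^ n).coeff n / 2 ^ n := by
  have := n.factorial_ne_zero
  rw [legendrePoly, eval_mul, eval_C, ← coeff_zero_eq_eval_zero, coeff_iterate_derivative]
  simp only [zero_add, Nat.descFactorial_self, nsmul_eq_mul]
  field_simp

theorem eval_zero_derivative (n : ℕ) :
    (derivative (legendrePoly n)).eval 0 =
      (n + 1) * ((X ^ 2 - 1 : ℝ[X]) ^ n).coeff (n + 1) / 2 ^ n := by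
  have := n.factorial_ne_zero
  rw [legendrePoly, derivative_C_mul, ← Function.iterate_succ_apply' (f := derivative), eval_mul,
    eval_C, ← coeff_zero_eq_eval_zero, coeff_iterate_derivative]
  simp only [zero_add, Nat.descFactorial_self, nsmul_eq_mul, Nat.succ_eq_add_one,
    Nat.factorial_succ]
  push_cast
  field_simp

theorem energy_at_zero_le {n : ℕ} (hn : 1 ≤ n) :
    (legendrePoly n).eval 0 ^ 2 +
      (derivative (legendrePoly n)).eval 0 ^ 2 / (n * (n + 1) + 1 / 2) ≤ 1 / n := by
  have hn' : (1 : ℝ) ≤ n := by exact_mod_cast hn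
  rw [eval_zero, eval_zero_derivative]
  rcases Nat.even_or_odd' n with ⟨m, hm | hm⟩
  · have h1 : ¬ 2 ∣ n + 1 := by omega
    have h2 : 2 ∣ n := by omega
    have h3 : n / 2 = m := by omega
    rw [coeff_X_sq_sub_one_pow, coeff_X_sq_sub_one_pow, if_neg h1, if_pos h2, h3]
    have hb := centralBinom_sq_le m
    have hc : (2 : ℝ) ^ n = 4 ^ m := by rw [hm, pow_mul]; norm_num
    have hd : n.choose m = m.centralBinom := by rw [hm, Nat.centralBinom]
    have hmn : (n : ℝ) = 2 * m := by exact_mod_cast hm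
    rw [hc, hd, mul_div_assoc, mul_pow, ← pow_mul, mul_comm _ 2, pow_mul]
    rw [← hmn] at hb
    rw [le_div_iff₀ (by positivity)]
    norm_num
    nlinarith [sq_nonneg ((m.centralBinom : ℝ) / 4 ^ m)]
  · have h1 : 2 ∣ n + 1 := by omega
    have h2 : ¬ 2 ∣ n := by omega
    have h3 : (n + 1) / 2 = m + 1 := by omega
    rw [coeff_X_sq_sub_one_pow, coeff_X_sq_sub_one_pow, if_neg h2, if_pos h1, h3]
    have hb := centralBinom_sq_le (m + 1)
    have hc : 2 * (2 : ℝ) ^ n = 4 ^ (m + 1) := by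
      rw [← pow_succ', hm, show 2 * m + 1 + 1 = 2 * (m + 1) by ring, pow_mul]; norm_num
    have hd : 2 * n.choose (m + 1) = (m + 1).centralBinom := by
      rw [Nat.centralBinom_eq_two_mul_choose, show 2 * (m + 1) = n + 1 by omega,
        Nat.choose_succ_succ', two_mul, hm]
      congr 1
      exact (Nat.choose_symm_half m)
    have hd' : 2 * (n.choose (m + 1) : ℝ) = (m + 1).centralBinom := by exact_mod_cast hd
    have hmn : (n : ℝ) = 2 * m + 1 := by exact_mod_cast hm
    have he : ((m + 1).centralBinom : ℝ) / 4 ^ (m + 1) = n.choose (m + 1) / 2 ^ n := by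
      rw [← hc, ← hd']; field_simp
    rw [he] at hb
    set t : ℝ := n.choose (m + 1) / 2 ^ n
    have hs : ((-1 : ℝ) ^ (n - (m + 1))) ^ 2 = 1 := by rw [← pow_mul, mul_comm, pow_mul]; simp
    have hf : ((n + 1 : ℝ) * ((-1) ^ (n - (m + 1)) * (n.choose (m + 1) : ℝ)) / 2 ^ n) ^ 2
        = (n + 1) ^ 2 * t ^ 2 := by
      linear_combination ((n + 1 : ℝ) * t) ^ 2 * hs
    rw [hf]
    push_cast at hb
    have hb' : (n + 2) * t ^ 2 ≤ 1 := by rw [hmn]; linarith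
    have ht : (n + 1) * t ^ 2 ≤ 1 := by nlinarith [sq_nonneg t]
    rw [zero_div, zero_pow two_ne_zero, zero_add, div_le_div_iff₀ (by positivity) (by positivity)]
    nlinarith [mul_nonneg (by positivity : (0 : ℝ) ≤ n * (n + 1)) (sub_nonneg.2 ht)]

/-- With `v θ = √(sin θ) P_n(cos θ)`, a solution of `v'' + q v = 0`, this is Sonin's function
`v² + v'² / q`. -/
noncomputable def sonin (n : ℕ) (θ : ℝ) : ℝ :=
  sin θ * (legendrePoly n).eval (cos θ) ^ 2 +
    sin θ * (cos θ * (legendrePoly n).eval (cos θ) / 2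
      - sin θ ^ 2 * (derivative (legendrePoly n)).eval (cos θ)) ^ 2
      / ((n * (n + 1) + 1 / 4) * sin θ ^ 2 + 1 / 4)

theorem hasDerivAt_sonin (n : ℕ) (θ : ℝ) :
    HasDerivAt (sonin n)
      (cos θ * (cos θ * (legendrePoly n).eval (cos θ) / 2
        - sin θ ^ 2 * (derivative (legendrePoly n)).eval (cos θ)) ^ 2
        / (2 * ((n * (n + 1) + 1 / 4) * sin θ ^ 2 + 1 / 4) ^ 2)) θ := by
  have hs := hasDerivAt_sin θ
  have hc := hasDerivAt_cos θ
  have hu := ((legendrePoly n).hasDerivAt (cos θ)).comp θ hc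
  have hd := ((derivative (legendrePoly n)).hasDerivAt (cos θ)).comp θ hc
  have hA := ((hc.mul hu).div_const 2).sub ((hs.pow 2).mul hd)
  have hD := ((hs.pow 2).const_mul (n * (n + 1) + 1 / 4 : ℝ)).add_const (1 / 4)
  have hpos : (0 : ℝ) < (n * (n + 1) + 1 / 4) * sin θ ^ 2 + 1 / 4 := by positivity
  have hF := (hs.mul (hu.pow 2)).add ((hs.mul (hA.pow 2)).div hD hpos.ne')
  refine hF.congr_deriv ?_
  have ode := differential_equation n (cos θ)
  have h1 := sin_sq_add_cos_sq θ
  simp only [Pi.pow_apply, Pi.mul_apply, Pi.sub_apply, Function.comp_apply]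
  set s := sin θ
  set c := cos θ
  set u := (legendrePoly n).eval c
  set d := (derivative (legendrePoly n)).eval c
  set e := (derivative (derivative (legendrePoly n))).eval c
  set l : ℝ := n * (n + 1)
  have hc2 : c ^ 2 = 1 - s ^ 2 := by linarith
  have hode : s ^ 2 * e = 2 * c * d - l * u := by
    rw [hc2] at ode; linear_combination ode
  have hA' : ∀ A', A' = -(s * u * (1 / 2 + l)) - c * s * d / 2 →
      c * u ^ 2 + s * (2 * u * (d * -s)) + ((c * (c * u / 2 - s ^ 2 * d) ^ 2 +
        s * (2 * (c * u / 2 - s ^ 2 * d) * A')) * ((l + 1 / 4) * s ^ 2 + 1 / 4) -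
        s * (c * u / 2 - s ^ 2 * d) ^ 2 * ((l + 1 / 4) * (2 * s * c))) /
          ((l + 1 / 4) * s ^ 2 + 1 / 4) ^ 2 =
      c * (c * u / 2 - s ^ 2 * d) ^ 2 / (2 * ((l + 1 / 4) * s ^ 2 + 1 / 4) ^ 2) := by
    rintro A' rfl
    rw [add_div' _ _ _ (by positivity), div_eq_div_iff (by positivity) (by positivity)]
    linear_combination (-((l + 1 / 4) * s ^ 2 + 1 / 4) ^ 3 * (c * u / 2 - s ^ 2 * d) * u) * h1
  rw [← hA' ((-s * u + c * (d * -s)) / 2 - (2 * s * c * d + s ^ 2 * (e * -s)))]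
  · norm_num
  · linear_combination s * hode

theorem monotoneOn_sonin (n : ℕ) : MonotoneOn (sonin n) (Set.Icc 0 (π / 2)) := by
  refine monotoneOn_of_deriv_nonneg (convex_Icc _ _)
    (fun θ _ => (hasDerivAt_sonin n θ).continuousAt.continuousWithinAt)
    (fun θ _ => (hasDerivAt_sonin n θ).differentiableAt.differentiableWithinAt) fun θ hθ => ?_
  rw [interior_Icc] at hθ
  rw [(hasDerivAt_sonin n θ).deriv]
  have : 0 ≤ cos θ := cos_nonneg_of_mem_Icc ⟨by linarith [hθ.1, hθ.2], hθ.2.le⟩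
  positivity

theorem sonin_le {n : ℕ} (hn : 1 ≤ n) {θ : ℝ} (hθ : θ ∈ Set.Icc 0 (π / 2)) :
    sonin n θ ≤ 1 / n := by
  have h := monotoneOn_sonin n hθ ⟨by positivity, le_rfl⟩ hθ.2
  refine h.trans (le_trans (le_of_eq ?_) (energy_at_zero_le hn))
  rw [sonin, sin_pi_div_two, cos_pi_div_two]
  ring_nf

theorem sin_cube_mul_sq_le {n : ℕ} (hn : 1 ≤ n) {θ : ℝ} (hθ : θ ∈ Set.Icc 0 (π / 2)) :
    sin θ ^ 3 * ((derivative (legendrePoly n)).eval (cos θ) * sin θ) ^ 2 ≤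
      (2 * (n * (n + 1) + 1 / 4) * sin θ ^ 2 + 1) / n := by
  have h := sonin_le hn hθ
  have hs : 0 ≤ sin θ := sin_nonneg_of_nonneg_of_le_pi hθ.1 (by linarith [hθ.2, pi_pos])
  have h1 := sin_sq_add_cos_sq θ
  rw [sonin] at h
  have hn' : (0 : ℝ) < n := by exact_mod_cast hn
  set s := sin θ
  set c := cos θ
  set u := (legendrePoly n).eval c
  set d := (derivative (legendrePoly n)).eval c
  have hD : (0 : ℝ) < (n * (n + 1) + 1 / 4) * s ^ 2 + 1 / 4 := by positivity
  set D := ((n : ℝ) * (n + 1) + 1 / 4) * s ^ 2 + 1 / 4 with hDdef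
  set A := c * u / 2 - s ^ 2 * d with hA
  have hu : s * u ^ 2 ≤ 1 / n := by
    have : 0 ≤ s * A ^ 2 / D := by positivity
    linarith
  have hA2 : s * A ^ 2 ≤ 1 / n * D := by
    rw [← div_le_iff₀ hD]
    have : 0 ≤ s * u ^ 2 := by positivity
    linarith
  have hc : c ^ 2 ≤ 1 := by nlinarith
  have e1 : s ^ 3 * (d * s) ^ 2 = s * (c * u / 2 - A) ^ 2 := by rw [hA]; ring
  have e2 : s * (c * u / 2 - A) ^ 2 ≤ c ^ 2 * (s * u ^ 2) / 2 + 2 * (s * A ^ 2) := by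
    nlinarith [mul_nonneg hs (sq_nonneg (c * u / 2 + A))]
  have e3 : c ^ 2 * (s * u ^ 2) ≤ 1 / n := by
    have : 0 ≤ s * u ^ 2 := by positivity
    nlinarith
  have e4 : (2 * (n * (n + 1) + 1 / 4) * s ^ 2 + 1) / n = 1 / n / 2 + 2 * (1 / n * D) := by
    rw [hDdef]; ring
  rw [e1, e4]
  linarith

end legendrePoly

/-- There are `C` and `N` such that for all `n ≥ N` and `θ ∈ [n^{−3/4}, π/2]`,
`(P_n'(cos θ) sin θ)²/P_n'(1) ≤ C n^{−1/4}`; in particular this sup tends to `0`. -/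
theorem legendre_deriv_decay_bulk :
    ∃ C : ℝ, ∃ N : ℕ, ∀ n : ℕ, N ≤ n →
      ∀ θ ∈ Set.Icc ((n : ℝ) ^ (-(3 : ℝ) / 4)) (π / 2),
        (deriv (legendre n) (cos θ) * sin θ) ^ 2 / deriv (legendre n) 1 ≤
          C * (n : ℝ) ^ (-(1 : ℝ) / 4) := by
  refine ⟨32, 1, fun n hn θ hθ => ?_⟩
  have hn' : (1 : ℝ) ≤ n := by exact_mod_cast hn
  have hn0 : (0 : ℝ) < n := by linarith
  have hθ0 : 0 < θ := lt_of_lt_of_le (rpow_pos_of_pos hn0 _) hθ.1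
  have key := legendrePoly.sin_cube_mul_sq_le hn ⟨hθ0.le, hθ.2⟩
  rw [legendrePoly.deriv_legendre, legendrePoly.deriv_legendre, legendrePoly.eval_one_derivative]
  have hsin : θ / 2 ≤ sin θ := by
    refine le_trans ?_ (mul_le_sin hθ0.le hθ.2)
    rw [div_mul_eq_mul_div, div_le_div_iff₀ two_pos pi_pos]
    nlinarith [pi_le_four]
  set r : ℝ := (n : ℝ) ^ (-(1 : ℝ) / 4) with hr
  have hr0 : 0 < r := rpow_pos_of_pos hn0 _
  have hr1 : r ≤ 1 := rpow_le_one_of_one_le_of_nonpos hn' (by norm_num)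
  have hnr : (n : ℝ) * (n : ℝ) ^ (-(3 : ℝ) / 4) * r = 1 := by
    rw [hr, mul_assoc, ← rpow_add hn0]
    norm_num
    rw [rpow_neg_one, mul_inv_cancel₀ hn0.ne']
  have hs0 : 0 < sin θ := by linarith
  set s := sin θ
  set Y := (Polynomial.eval (cos θ) (Polynomial.derivative (legendrePoly n)) * s) ^ 2
  have hnsr : 1 ≤ 2 * (n * s * r) := by
    have : (n : ℝ) ^ (-(3 : ℝ) / 4) ≤ 2 * s := by linarith [hθ.1]
    nlinarith [mul_le_mul_of_nonneg_left this (mul_pos hn0 hr0).le]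
  rw [div_le_iff₀ (by positivity)]
  rw [le_div_iff₀ hn0] at key
  have hl : 2 * ((n : ℝ) * (n + 1) + 1 / 4) ≤ 4 * (n * (n + 1)) := by nlinarith
  have h1 : 1 ≤ 4 * (n * s * r) ^ 2 := by nlinarith
  have h2 : 1 ≤ 4 * (n * (n + 1)) * s ^ 2 := by
    have hr2 : r ^ 2 ≤ 1 := pow_le_one₀ hr0.le hr1
    have : 4 * (n * s * r) ^ 2 ≤ 4 * (n * s) ^ 2 := by
      rw [mul_pow _ r]; nlinarith [sq_nonneg (n * s)]
    nlinarith [mul_pos hn0 (pow_pos hs0 2)]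
  have h3 : s ^ 3 * Y * n ≤ 8 * (n * (n + 1)) * s ^ 2 := by
    nlinarith [mul_le_mul_of_nonneg_right hl (sq_nonneg s)]
  have h4 : Y * (n * s) ≤ 8 * (n * (n + 1)) := by
    have hs2 : 0 < s ^ 2 := by positivity
    refine le_of_mul_le_mul_right ?_ hs2
    linarith
  calc Y ≤ Y * (2 * (n * s * r)) := le_mul_of_one_le_right (sq_nonneg _) hnsr
    _ = 2 * r * (Y * (n * s)) := by ring
    _ ≤ 2 * r * (8 * (n * (n + 1))) := by gcongr
    _ = 32 * r * (n * (n + 1) / 2) := by ring
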